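/- arXiv:2203.11515 — 2 statements merged into one kernel-verified Lean document; each statement's English description precedes it below -/
import Mathlib

section
/- Let γ ∈ (0,1], and let F = (F₁,F₂) : [0,∞) × ℝ^{2d} → ℝ^d × ℝ^d be smooth in space with all spatial derivatives bounded and satisfy: |F₁(t,0)| ≤ κ₁, |F₂(t,0)| ≤ κ₂, ‖F₁(t,·)‖_{𝒞⁰_𝐝} ≤ κ₁ and ‖F₂(t,·)‖_{𝒞^{1+γ}_𝐝} ≤ κ₂ for all t. Let θ_{t,s} be the flow of F and ϑ^{(t,y)}_{t,s}(x) the frozen linearized flow along θ_{·,t}(y). Then for every T > 0 there is a constant C > 0, depending only on T, κ₁, κ₂, d, γ, such that for all 0 ≤ s ≤ t ≤ T and x, y ∈ ℝ^{2d}: |𝕋_{t−s}^{-1}( θ_{t,s}(x) − ϑ^{(t,y)}_{t,s}(x) )| ≤ C·(t−s)^{γ/2}·( |𝕋_{t−s}^{-1}(θ_{t,s}(x) − y)|^{1+γ} + 1 ). -/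
open MeasureTheory Real

noncomputable section

/-- Points of `ℝ^{2d}`, split into the two `ℝ^d`-components. -/
abbrev Vec (d : ℕ) := EuclideanSpace ℝ (Fin d)

/-- `|𝕋_t⁻¹ x|`, `𝕋_t` block-diagonal with blocks `t^{1/2}·I` and `t^{3/2}·I`. -/
def TinvNorm {d : ℕ} (t : ℝ) (x : Vec d × Vec d) : ℝ :=
  Real.sqrt (‖x.1‖ ^ 2 / t + ‖x.2‖ ^ 2 / t ^ 3)

/-- The linear map `𝐀(r,z)` on `ℝ^{2d}`: all blocks zero except the lower-left one, which is
the Jacobian `∇_{x₁}F₂(r,z)`. -/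
def Afun {d : ℕ} (F : ℝ → Vec d × Vec d → Vec d × Vec d) (r : ℝ) (z w : Vec d × Vec d) :
    Vec d × Vec d :=
  ((0 : Vec d), fderiv ℝ (fun v : Vec d => (F r (v, z.2)).2) z.1 w.1)

/-- The Jacobian `∇_{x₁}F₂(t,x)` as a continuous linear map. -/
def grad1F2 {d : ℕ} (F : ℝ → Vec d × Vec d → Vec d × Vec d) (t : ℝ) (x : Vec d × Vec d) :
    Vec d →L[ℝ] Vec d :=
  fderiv ℝ (fun v : Vec d => (F t (v, x.2)).2) x.1


section Increments

variable {E G : Type*} [NormedAddCommGroup E] [NormedSpace ℝ E] [NormedAddCommGroup G]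

/-- A function whose oscillation at scale at most one is bounded grows at most linearly. -/
lemma norm_sub_le_of_osc {g : E → G} {κ : ℝ}
    (hg : ∀ z z', ‖z - z'‖ ≤ 1 → ‖g z - g z'‖ ≤ κ) (z z' : E) :
    ‖g z - g z'‖ ≤ κ * (1 + ‖z - z'‖) := by
  have hκ : 0 ≤ κ := (norm_nonneg _).trans (hg 0 0 (by simp))
  have key : ∀ n : ℕ, ∀ z z' : E, ‖z - z'‖ ≤ n + 1 → ‖g z - g z'‖ ≤ κ * (n + 1) := by
    intro n
    induction n with
    | zero => intro z z' h; simpa using hg z z' (by simpa using h)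
    | succ n ih =>
      intro z z' h
      push_cast at h ⊢
      have hn : (0 : ℝ) < n + 1 + 1 := by positivity
      set w : E := z' + ((n : ℝ) + 1 + 1)⁻¹ • (z - z') with hw
      have h1 : ‖w - z'‖ ≤ 1 := by
        rw [hw, add_sub_cancel_left, norm_smul, norm_inv, Real.norm_of_nonneg hn.le]
        exact inv_mul_le_one_of_le₀ h hn.le
      have h2 : ‖z - w‖ ≤ n + 1 := by
        have e : z - w = (((n : ℝ) + 1) / (n + 1 + 1)) • (z - z') := by
          rw [hw, ← sub_sub]
          nth_rewrite 1 [← one_smul ℝ (z - z')]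
          rw [← sub_smul]
          congr 1
          field_simp
          ring
        rw [e, norm_smul, Real.norm_of_nonneg (by positivity), div_mul_eq_mul_div, div_le_iff₀ hn]
        gcongr
      calc ‖g z - g z'‖ ≤ ‖g z - g w‖ + ‖g w - g z'‖ := norm_sub_le_norm_sub_add_norm_sub _ _ _
        _ ≤ κ * (n + 1) + κ := add_le_add (ih _ _ h2) (hg _ _ h1)
        _ = κ * (n + 1 + 1) := by ring
  calc ‖g z - g z'‖ ≤ κ * (⌊‖z - z'‖⌋₊ + 1) := key _ z z' (Nat.lt_floor_add_one _).le
    _ ≤ κ * (1 + ‖z - z'‖) := by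
      rw [add_comm 1]
      gcongr
      exact Nat.floor_le (norm_nonneg _)

/-- A function that is Hölder at scale at most one has a modulus of continuity of Hölder type at
small scales and of linear type at large scales. -/
lemma norm_sub_le_of_holder {g : E → G} {κ β : ℝ} (hβ : 0 ≤ β) (hκ : 0 ≤ κ)
    (hg : ∀ z z', ‖z - z'‖ ≤ 1 → ‖g z - g z'‖ ≤ κ * ‖z - z'‖ ^ β) (z z' : E) :
    ‖g z - g z'‖ ≤ κ * (‖z - z'‖ ^ β + 2 * ‖z - z'‖) := by
  rcases le_total ‖z - z'‖ 1 with h | h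
  · refine (hg z z' h).trans ?_
    gcongr
    linarith [norm_nonneg (z - z')]
  · have h1 := norm_sub_le_of_osc (g := g) (κ := κ) (fun z z' h => (hg z z' h).trans
      (mul_le_of_le_one_right hκ (Real.rpow_le_one (norm_nonneg _) h hβ))) z z'
    have := Real.rpow_nonneg (norm_nonneg (z - z')) β
    exact h1.trans (mul_le_mul_of_nonneg_left (by linarith) hκ)

/-- First-order Taylor estimate for a function with bounded derivative which is Hölder at scale
at most one. -/
lemma norm_sub_sub_fderiv_le [NormedSpace ℝ G] {g : E → G} {κ γ : ℝ} (hγ : 0 ≤ γ)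
    (hd : Differentiable ℝ g) (hb : ∀ z, ‖fderiv ℝ g z‖ ≤ κ)
    (hg : ∀ z z', ‖z - z'‖ ≤ 1 → ‖fderiv ℝ g z - fderiv ℝ g z'‖ ≤ κ * ‖z - z'‖ ^ γ) (z z' : E) :
    ‖g z' - g z - fderiv ℝ g z (z' - z)‖ ≤ 2 * κ * (‖z' - z‖ ^ γ * ‖z' - z‖) := by
  have hκ : 0 ≤ κ := (norm_nonneg _).trans (hb z)
  rw [← mul_assoc]
  refine (convex_closedBall z ‖z' - z‖).norm_image_sub_le_of_norm_fderiv_le' (𝕜 := ℝ)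
    (fun x _ => hd x) (fun x hx => ?_) (by simp) (by simp [dist_eq_norm])
  rw [Metric.mem_closedBall, dist_eq_norm] at hx
  rcases le_total ‖x - z‖ 1 with h | h
  · calc ‖fderiv ℝ g x - fderiv ℝ g z‖ ≤ κ * ‖x - z‖ ^ γ := hg _ _ h
      _ ≤ κ * ‖z' - z‖ ^ γ := by gcongr
      _ ≤ 2 * κ * ‖z' - z‖ ^ γ := by
        have : 0 ≤ κ * ‖z' - z‖ ^ γ := by positivity
        linarith
  · calc ‖fderiv ℝ g x - fderiv ℝ g z‖ ≤ ‖fderiv ℝ g x‖ + ‖fderiv ℝ g z‖ := norm_sub_le _ _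
      _ ≤ 2 * κ := by linarith [hb x, hb z]
      _ ≤ 2 * κ * ‖z' - z‖ ^ γ :=
        le_mul_of_one_le_right (by positivity) (Real.one_le_rpow (h.trans hx) hγ)

end Increments

section Measurability

variable {E : Type*} [NormedAddCommGroup E] [NormedSpace ℝ E]

/-- A time-dependent vector field which is uniformly Lipschitz in space and admits a flow is
jointly measurable. -/
lemma measurable_uncurry_of_flow [MeasurableSpace E] [BorelSpace E] [SecondCountableTopology E]
    {F : ℝ → E → E} {θ : ℝ → ℝ → E → E} {K : NNReal} (hF : ∀ t, LipschitzWith K (F t))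
    (h0 : ∀ s x, θ s s x = x)
    (hθ : ∀ s x t, HasDerivAt (fun u => θ u s x) (F t (θ t s x)) t) :
    Measurable (fun p : E × ℝ => F p.2 p.1) := by
  refine measurable_uncurry_of_continuous_of_measurable (u := fun x t => F t x)
    (fun t => (hF t).continuous) (fun z => ?_)
  have hc : ∀ s x, Continuous (fun u => θ u s x) :=
    fun s x => continuous_iff_continuousAt.2 fun t => (hθ s x t).continuousAt
  have hcont : ∀ δ : ℝ, 0 ≤ δ → Continuous fun r => θ (r + δ) r z := by
    intro δ hδ
    refine continuous_iff_continuousAt.2 fun r₀ => ?_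
    have hb : ∀ r, dist (θ (r + δ) r z) (θ (r + δ) r₀ z) ≤
        dist z (θ r r₀ z) * Real.exp (K * δ) := by
      intro r
      have := dist_le_of_trajectories_ODE (v := F) (K := K) (f := fun u => θ u r z)
        (g := fun u => θ u r₀ z) (a := r) (b := r + δ) (δ := dist z (θ r r₀ z)) hF
        (hc _ _).continuousOn (fun t _ => (hθ _ _ t).hasDerivWithinAt)
        (hc _ _).continuousOn (fun t _ => (hθ _ _ t).hasDerivWithinAt)
        (by simp [h0]) (r + δ) ⟨by linarith, le_rfl⟩
      simpa using this
    have hlim : Filter.Tendsto (fun r => dist (θ (r + δ) r z) (θ (r + δ) r₀ z)) (nhds r₀)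
        (nhds 0) := by
      refine squeeze_zero (fun _ => dist_nonneg) hb ?_
      have : Continuous fun r => dist z (θ r r₀ z) * Real.exp (K * δ) :=
        (continuous_const.dist (hc r₀ z)).mul continuous_const
      simpa [h0] using this.tendsto r₀
    exact (tendsto_iff_of_dist hlim).2
      (((hc r₀ z).comp (continuous_id.add continuous_const)).tendsto r₀)
  refine measurable_of_tendsto_metrizable
    (f := fun (n : ℕ) r => ((n : ℝ) + 1) • (θ (r + ((n : ℝ) + 1)⁻¹) r z - z))
    (fun n => (((hcont _ (by positivity)).sub continuous_const).const_smul _).measurable) ?_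
  refine tendsto_pi_nhds.2 fun r => ?_
  have h := (hθ r z r).tendsto_slope_zero_right
  rw [h0] at h
  have hn : Filter.Tendsto (fun n : ℕ => ((n : ℝ) + 1)⁻¹) Filter.atTop (nhdsWithin 0 (Set.Ioi 0)) :=
    tendsto_inv_atTop_nhdsGT_zero.comp
      (Filter.tendsto_atTop_add_const_right _ _ tendsto_natCast_atTop_atTop)
  simpa [Function.comp_def] using h.comp hn

end Measurability

section FrozenFlow

/-- A measurable function which is bounded on a compact interval is integrable there. -/
lemma intervalIntegrable_of_measurable_of_bound {G : Type*} [NormedAddCommGroup G]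
    [MeasurableSpace G] [BorelSpace G] [SecondCountableTopology G] {f : ℝ → G} {s t C : ℝ}
    (hst : s ≤ t) (hf : Measurable f) (hC : ∀ r ∈ Set.Icc s t, ‖f r‖ ≤ C) :
    IntervalIntegrable f volume s t := by
  rw [intervalIntegrable_iff_integrableOn_Ioc_of_le hst]
  refine IntegrableOn.of_bound (by simp) hf.aestronglyMeasurable C ?_
  filter_upwards [ae_restrict_mem measurableSet_Ioc] with r hr
  exact hC r (Set.Ioc_subset_Icc_self hr)

variable {d : ℕ} {F : ℝ → Vec d × Vec d → Vec d × Vec d} {K : NNReal} {κ s t : ℝ}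

lemma intervalIntegrable_comp_path (hst : s ≤ t) (hs : 0 ≤ s) (hF : ∀ t, LipschitzWith K (F t))
    (hm : Measurable fun p : (Vec d × Vec d) × ℝ => F p.2 p.1) (hF0 : ∀ t, 0 ≤ t → ‖F t 0‖ ≤ κ)
    {b : ℝ → Vec d × Vec d} (hb : Continuous b) :
    IntervalIntegrable (fun r => F r (b r)) volume s t := by
  obtain ⟨B, hB⟩ := isCompact_Icc.exists_bound_of_continuousOn (s := Set.Icc s t) hb.continuousOn
  refine intervalIntegrable_of_measurable_of_bound hst (C := κ + K * B)
    (hm.comp (hb.measurable.prodMk measurable_id)) fun r hr => ?_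
  have h1 := (hF r).norm_sub_le (b r) 0
  rw [sub_zero] at h1
  calc ‖F r (b r)‖ ≤ ‖F r 0‖ + ‖F r (b r) - F r 0‖ := norm_le_norm_add_norm_sub' _ _
    _ ≤ κ + K * B := add_le_add (hF0 r (hs.trans hr.1)) (h1.trans (by gcongr; exact hB r hr))

lemma hasFDerivAt_snd_left (hd : ∀ t, Differentiable ℝ (F t)) (t : ℝ) (x : Vec d × Vec d) :
    HasFDerivAt (fun v => (F t (v, x.2)).2) (grad1F2 F t x) x.1 := by
  have : Differentiable ℝ fun v : Vec d => (F t (v, x.2)).2 :=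
    ((hd t).comp (differentiable_id.prodMk (differentiable_const _))).snd
  exact (this x.1).hasFDerivAt

lemma measurable_grad1F2_apply (hd : ∀ t, Differentiable ℝ (F t))
    (hm : Measurable fun p : (Vec d × Vec d) × ℝ => F p.2 p.1)
    {b : ℝ → Vec d × Vec d} (hb : Measurable b) {w : ℝ → Vec d} (hw : Measurable w) :
    Measurable fun r => grad1F2 F r (b r) (w r) := by
  refine measurable_of_tendsto_metrizable
    (f := fun (n : ℕ) r => (n : ℝ) • ((F r ((b r).1 + (n : ℝ)⁻¹ • w r, (b r).2)).2
      - (F r ((b r).1, (b r).2)).2)) (fun n => ?_) (tendsto_pi_nhds.2 fun r => ?_)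
  · have h1 : Measurable fun r => F r ((b r).1 + (n : ℝ)⁻¹ • w r, (b r).2) :=
      have hwn : Measurable fun r => (n : ℝ)⁻¹ • w r := (measurable_const_smul _).comp hw
      hm.comp (((hb.fst.add hwn).prodMk hb.snd).prodMk measurable_id)
    have h2 : Measurable fun r => F r ((b r).1, (b r).2) :=
      hm.comp ((hb.fst.prodMk hb.snd).prodMk measurable_id)
    exact (h1.snd.sub h2.snd).const_smul (n : ℝ)
  · exact ((hasFDerivAt_snd_left hd r (b r)).lim_real (w r)).comp tendsto_natCast_atTop_atTop

/-- Along the frozen linearized equation, the first component of the deviation from the freezing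
path is constant, so that the equation is solved by an explicit integral. -/
lemma frozen_flow_eq (hst : s ≤ t) (hs : 0 ≤ s) (hF : ∀ t, LipschitzWith K (F t))
    (hd : ∀ t, Differentiable ℝ (F t))
    (hm : Measurable fun p : (Vec d × Vec d) × ℝ => F p.2 p.1)
    (hF0 : ∀ t, 0 ≤ t → ‖F t 0‖ ≤ κ) {κ' : ℝ} (hA : ∀ t x, 0 ≤ t → ‖grad1F2 F t x‖ ≤ κ')
    {b v : ℝ → Vec d × Vec d} {x : Vec d × Vec d} (hb : ∀ r, HasDerivAt b (F r (b r)) r)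
    (hv : ∀ r, v r = x + ∫ u in s..r, (F u (b u) + Afun F u (b u) (v u - b u))) :
    IntervalIntegrable
        (fun r => F r (b r) + ((0 : Vec d), grad1F2 F r (b r) (x.1 - (b s).1))) volume s t ∧
      v t = x + ∫ r in s..t, (F r (b r) + ((0 : Vec d), grad1F2 F r (b r) (x.1 - (b s).1))) := by
  set g : ℝ → Vec d × Vec d := fun u => F u (b u) + Afun F u (b u) (v u - b u) with hg
  have hbc : Continuous b := continuous_iff_continuousAt.2 fun r => (hb r).continuousAt
  set J : Set ℝ := {r | s ≤ r ∧ IntervalIntegrable g volume s r} with hJ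
  have hmono : ∀ r₂ ∈ J, ∀ r, s ≤ r → r ≤ r₂ → r ∈ J := fun r₂ h₂ r hsr hr =>
    ⟨hsr, h₂.2.mono_set (by
      rw [Set.uIcc_of_le hsr, Set.uIcc_of_le h₂.1]; exact Set.Icc_subset_Icc_right hr)⟩
  have hJm : MeasurableSet J := Set.OrdConnected.measurableSet
    ⟨fun r₁ h₁ r₂ h₂ r hr => hmono r₂ h₂ r (h₁.1.trans hr.1) hr.2⟩
  classical
  set w : ℝ → Vec d := J.piecewise (fun _ => x.1 - (b s).1) (fun r => x.1 - (b r).1) with hw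
  have hwm : Measurable w := measurable_const.piecewise hJm
    (continuous_const.sub hbc.fst).measurable
  have hvw : ∀ r, s ≤ r → (v r).1 - (b r).1 = w r := by
    intro r hr
    by_cases hrJ : r ∈ J
    · have hi : (∫ u in s..r, g u).1 = (b r).1 - (b s).1 := by
        have h1 := (ContinuousLinearMap.fst ℝ (Vec d) (Vec d)).intervalIntegral_comp_comm hrJ.2
        have hFi := intervalIntegrable_comp_path hr hs hF hm hF0 hbc
        have h2 := (ContinuousLinearMap.fst ℝ (Vec d) (Vec d)).intervalIntegral_comp_comm hFi
        rw [intervalIntegral.integral_eq_sub_of_hasDerivAt (fun u _ => hb u) hFi] at h2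
        rw [← Prod.fst_sub]
        refine Eq.trans h1.symm (Eq.trans ?_ h2)
        simp [hg, Afun]
      rw [hw, Set.piecewise_eq_of_mem _ _ _ hrJ, hv r, Prod.fst_add, hi]
      abel
    · rw [hw, Set.piecewise_eq_of_notMem _ _ _ hrJ, hv r, intervalIntegral.integral_undef
        (fun h => hrJ ⟨hr, h⟩), add_zero]
  have hgw : ∀ r, s ≤ r → g r = F r (b r) + ((0 : Vec d), grad1F2 F r (b r) (w r)) := by
    intro r hr
    rw [← hvw r hr]
    rfl
  obtain ⟨B, hB⟩ := isCompact_Icc.exists_bound_of_continuousOn (s := Set.Icc s t) hbc.continuousOn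
  have hwB : ∀ r ∈ Set.Icc s t, ‖w r‖ ≤ ‖x‖ + B := by
    intro r hr
    have hle : ∀ r' ∈ Set.Icc s t, ‖x.1 - (b r').1‖ ≤ ‖x‖ + B := fun r' hr' =>
      (norm_sub_le _ _).trans (add_le_add (norm_fst_le x) ((norm_fst_le _).trans (hB r' hr')))
    by_cases hrJ : r ∈ J
    · rw [hw, Set.piecewise_eq_of_mem _ _ _ hrJ]
      exact hle s ⟨le_rfl, hst⟩
    · rw [hw, Set.piecewise_eq_of_notMem _ _ _ hrJ]
      exact hle r hr
  have hAi : IntervalIntegrable (fun r => ((0 : Vec d), grad1F2 F r (b r) (w r))) volume s t := by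
    refine intervalIntegrable_of_measurable_of_bound hst (C := κ' * (‖x‖ + B))
      (measurable_const.prodMk (measurable_grad1F2_apply hd hm hbc.measurable hwm)) fun r hr => ?_
    have h0 := hA r (b r) (hs.trans hr.1)
    rw [Prod.norm_mk, norm_zero, max_eq_right (norm_nonneg _)]
    exact (ContinuousLinearMap.le_opNorm _ _).trans
      (mul_le_mul h0 (hwB r hr) (norm_nonneg _) ((norm_nonneg _).trans h0))
  have hgi : IntervalIntegrable g volume s t := by
    refine ((intervalIntegrable_comp_path hst hs hF hm hF0 hbc).add hAi).congr ?_
    intro r hr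
    rw [Set.uIoc_of_le hst] at hr
    exact (hgw r hr.1.le).symm
  have heq : Set.EqOn g
      (fun r => F r (b r) + ((0 : Vec d), grad1F2 F r (b r) (x.1 - (b s).1))) (Set.uIcc s t) := by
    intro r hr
    rw [Set.uIcc_of_le hst] at hr
    rw [hgw r hr.1, hw, Set.piecewise_eq_of_mem _ _ _ (hmono t ⟨hst, hgi⟩ r hr.1 hr.2)]
  refine ⟨hgi.congr fun r hr => heq (Set.uIoc_subset_uIcc hr), ?_⟩
  rw [hv t, intervalIntegral.integral_congr heq]

end FrozenFlow

section Estimates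

lemma rpow_third_le {γ q ρ x : ℝ} (hγ : γ ∈ Set.Ioc (0 : ℝ) 1) (hq : 0 < q) (hx : 0 ≤ x)
    (hρ : 0 ≤ ρ) (h : x ≤ q ^ 3 * ρ) : x ^ ((1 + γ) / 3) ≤ q * q ^ γ * (1 + ρ) := by
  have hβ : 0 ≤ (1 + γ) / 3 := by linarith [hγ.1]
  have hβ1 : (1 + γ) / 3 ≤ 1 := by linarith [hγ.2]
  have e : (q ^ 3) ^ ((1 + γ) / 3) = q * q ^ γ := by
    rw [← Real.rpow_natCast, ← Real.rpow_mul hq.le]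
    nth_rewrite 2 [← Real.rpow_one q]
    rw [← Real.rpow_add hq]
    congr 1
    push_cast
    ring
  calc x ^ ((1 + γ) / 3) ≤ (q ^ 3 * ρ) ^ ((1 + γ) / 3) := Real.rpow_le_rpow hx h hβ
    _ = q * q ^ γ * ρ ^ ((1 + γ) / 3) := by rw [Real.mul_rpow (by positivity) hρ, e]
    _ ≤ q * q ^ γ * (1 + ρ) := by
      gcongr
      calc ρ ^ ((1 + γ) / 3) ≤ (1 + ρ) ^ ((1 + γ) / 3) := by gcongr; linarith
        _ ≤ (1 + ρ) ^ (1 : ℝ) := Real.rpow_le_rpow_of_exponent_le (by linarith) hβ1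
        _ = 1 + ρ := Real.rpow_one _

variable {d : ℕ} {F : ℝ → Vec d × Vec d → Vec d × Vec d} {γ κ₁ κ₂ : ℝ} {t : ℝ}

lemma norm_fst_field_sub_le
    (h₁ : ∀ x₂ z z' : Vec d, ‖z - z'‖ ≤ 1 → ‖(F t (z, x₂)).1 - (F t (z', x₂)).1‖ ≤ κ₁)
    (h₂ : ∀ x₁ w w' : Vec d, ‖w - w'‖ ≤ 1 → ‖(F t (x₁, w)).1 - (F t (x₁, w')).1‖ ≤ κ₁)
    (a b : Vec d × Vec d) :
    ‖(F t a).1 - (F t b).1‖ ≤ κ₁ * (2 + ‖a.1 - b.1‖ + ‖a.2 - b.2‖) := by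
  have e₁ := norm_sub_le_of_osc (g := fun w => (F t (a.1, w)).1) (h₂ a.1) a.2 b.2
  have e₂ := norm_sub_le_of_osc (g := fun z => (F t (z, b.2)).1) (h₁ b.2) a.1 b.1
  calc ‖(F t a).1 - (F t b).1‖
      ≤ ‖(F t (a.1, a.2)).1 - (F t (a.1, b.2)).1‖ + ‖(F t (a.1, b.2)).1 - (F t (b.1, b.2)).1‖ :=
        norm_sub_le_norm_sub_add_norm_sub _ _ _
    _ ≤ _ := (add_le_add e₁ e₂).trans (le_of_eq (by ring))

lemma norm_snd_field_sub_le (hγ : 0 < γ) (hκ₂ : 0 ≤ κ₂) (hd : ∀ t, Differentiable ℝ (F t))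
    (hA : ∀ x, ‖grad1F2 F t x‖ ≤ κ₂)
    (h₂ : ∀ x₁ w w' : Vec d, ‖w - w'‖ ≤ 1 →
      ‖(F t (x₁, w)).2 - (F t (x₁, w')).2‖ ≤ κ₂ * ‖w - w'‖ ^ ((1 + γ) / 3))
    (a b : Vec d × Vec d) :
    ‖(F t a).2 - (F t b).2‖ ≤
      κ₂ * (‖a.1 - b.1‖ + (‖a.2 - b.2‖ ^ ((1 + γ) / 3) + 2 * ‖a.2 - b.2‖)) := by
  have e₁ := norm_sub_le_of_holder (g := fun w => (F t (a.1, w)).2)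
    (by linarith : 0 ≤ (1 + γ) / 3) hκ₂ (h₂ a.1) a.2 b.2
  have e₂ : ‖(F t (a.1, b.2)).2 - (F t (b.1, b.2)).2‖ ≤ κ₂ * ‖a.1 - b.1‖ :=
    convex_univ.norm_image_sub_le_of_norm_hasFDerivWithin_le (f := fun z => (F t (z, b.2)).2)
      (fun z _ => (hasFDerivAt_snd_left hd t (z, b.2)).hasFDerivWithinAt)
      (fun z _ => hA (z, b.2)) (Set.mem_univ _) (Set.mem_univ _)
  calc ‖(F t a).2 - (F t b).2‖
      ≤ ‖(F t (a.1, a.2)).2 - (F t (a.1, b.2)).2‖ + ‖(F t (a.1, b.2)).2 - (F t (b.1, b.2)).2‖ :=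
        norm_sub_le_norm_sub_add_norm_sub _ _ _
    _ ≤ _ := (add_le_add e₁ e₂).trans (le_of_eq (by ring))

lemma norm_snd_field_sub_sub_grad_le (hγ : 0 < γ) (hκ₂ : 0 ≤ κ₂)
    (hd : ∀ t, Differentiable ℝ (F t)) (hA : ∀ x, ‖grad1F2 F t x‖ ≤ κ₂)
    (h₁ : ∀ x₂ z z' : Vec d, ‖z - z'‖ ≤ 1 →
      ‖grad1F2 F t (z, x₂) - grad1F2 F t (z', x₂)‖ ≤ κ₂ * ‖z - z'‖ ^ γ)
    (h₂ : ∀ x₁ w w' : Vec d, ‖w - w'‖ ≤ 1 →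
      ‖(F t (x₁, w)).2 - (F t (x₁, w')).2‖ ≤ κ₂ * ‖w - w'‖ ^ ((1 + γ) / 3))
    (a b : Vec d × Vec d) :
    ‖(F t a).2 - (F t b).2 - grad1F2 F t b (a.1 - b.1)‖ ≤
      κ₂ * (‖a.2 - b.2‖ ^ ((1 + γ) / 3) + 2 * ‖a.2 - b.2‖) +
        2 * κ₂ * (‖a.1 - b.1‖ ^ γ * ‖a.1 - b.1‖) := by
  have e₁ := norm_sub_le_of_holder (g := fun w => (F t (a.1, w)).2)
    (by linarith : 0 ≤ (1 + γ) / 3) hκ₂ (h₂ a.1) a.2 b.2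
  have e₂ := norm_sub_sub_fderiv_le (g := fun z => (F t (z, b.2)).2) hγ.le
    (fun z => (hasFDerivAt_snd_left hd t (z, b.2)).differentiableAt) (fun z => hA (z, b.2))
    (h₁ b.2) b.1 a.1
  refine le_trans (le_of_eq ?_) ((norm_add_le _ _).trans (add_le_add e₁ e₂))
  congr 1
  simp only [grad1F2]
  abel

/-- Grönwall estimate on a time interval of length `q ^ 2` for a pair of increments with
anisotropic scaling `q`, `q ^ 3`, propagating backwards from the terminal time. -/
lemma anisotropic_gronwall {V : Type*} [NormedAddCommGroup V] [NormedSpace ℝ V]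
    {s q Q N : ℝ} (hγ : γ ∈ Set.Ioc (0 : ℝ) 1) (hκ₁ : 0 < κ₁) (hκ₂ : 0 < κ₂)
    (hq : 0 < q) (hqQ : q ≤ Q) (hst : q ^ 2 = t - s)
    {e e' : ℝ → V × V} (he : ∀ r, HasDerivAt e (e' r) r)
    (h₁ : ∀ r ∈ Set.Icc s t, ‖(e' r).1‖ ≤ κ₁ * (2 + ‖(e r).1‖ + ‖(e r).2‖))
    (h₂ : ∀ r ∈ Set.Icc s t, ‖(e' r).2‖ ≤
      κ₂ * (‖(e r).1‖ + (‖(e r).2‖ ^ ((1 + γ) / 3) + 2 * ‖(e r).2‖)))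
    (hN₁ : ‖(e t).1‖ ≤ q * N) (hN₂ : ‖(e t).2‖ ≤ q ^ 3 * N) :
    ∀ r ∈ Set.Icc s t,
      ‖(e r).1‖ ≤ q * (Real.exp (κ₁ * (2 * Q + Q ^ 2 + Q ^ 4) + κ₂ * (1 + Q ^ γ + 2 * Q ^ 2)) *
        (N + 1)) ∧
      ‖(e r).2‖ ≤ q ^ 3 *
        (Real.exp (κ₁ * (2 * Q + Q ^ 2 + Q ^ 4) + κ₂ * (1 + Q ^ γ + 2 * Q ^ 2)) * (N + 1)) := by
  have hQ : 0 < Q := hq.trans_le hqQ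
  set M := κ₁ * (2 * Q + Q ^ 2 + Q ^ 4) + κ₂ * (1 + Q ^ γ + 2 * Q ^ 2) with hM
  have hM0 : 0 < M := by positivity
  set f : ℝ → V × V := fun r => (q⁻¹ • (e (t - r)).1, (q ^ 3)⁻¹ • (e (t - r)).2) with hf
  set f' : ℝ → V × V := fun r => (q⁻¹ • (-e' (t - r)).1, (q ^ 3)⁻¹ • (-e' (t - r)).2) with hf'
  have hfd : ∀ r, HasDerivAt f (f' r) r := by
    intro r
    have h := (he (t - r)).comp_const_sub t r
    exact ((hasFDerivAt_fst.comp_hasDerivAt r h).const_smul q⁻¹).prodMk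
      ((hasFDerivAt_snd.comp_hasDerivAt r h).const_smul (q ^ 3)⁻¹)
  have hn₁ : ∀ r, ‖(e (t - r)).1‖ ≤ q * ‖f r‖ := by
    intro r
    have := norm_fst_le (f r)
    simp only [hf, norm_smul, norm_inv, Real.norm_of_nonneg hq.le] at this
    rwa [inv_mul_le_iff₀ hq] at this
  have hn₂ : ∀ r, ‖(e (t - r)).2‖ ≤ q ^ 3 * ‖f r‖ := by
    intro r
    have := norm_snd_le (f r)
    simp only [hf, norm_smul, norm_inv, norm_pow, Real.norm_of_nonneg hq.le] at this
    rwa [inv_mul_le_iff₀ (by positivity)] at this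
  have h0 : ‖f 0‖ ≤ N := by
    refine max_le ?_ ?_
    · simpa [hf, norm_smul, abs_of_pos hq, inv_mul_le_iff₀ hq] using hN₁
    · simpa [hf, norm_smul, abs_of_pos hq, inv_mul_le_iff₀ (pow_pos hq 3)] using hN₂
  have hbound : ∀ r ∈ Set.Ico 0 (q ^ 2), ‖f' r‖ ≤ M / q ^ 2 * ‖f r‖ + M / q ^ 2 := by
    intro r hr
    have hr' : t - r ∈ Set.Icc s t := ⟨by linarith [hr.2], by linarith [hr.1]⟩
    have hρ : 0 ≤ ‖f r‖ := norm_nonneg _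
    have b₃ := rpow_third_le hγ hq (norm_nonneg _) hρ (hn₂ r)
    have hqγ : q ^ γ ≤ Q ^ γ := Real.rpow_le_rpow hq.le hqQ hγ.1.le
    have hM₁ : κ₁ * (2 * Q + Q ^ 2 + Q ^ 4) ≤ M := by
      rw [hM]; linarith [show 0 < κ₂ * (1 + Q ^ γ + 2 * Q ^ 2) by positivity]
    have hM₂ : κ₂ * (1 + Q ^ γ + 2 * Q ^ 2) ≤ M := by
      rw [hM]; linarith [show 0 < κ₁ * (2 * Q + Q ^ 2 + Q ^ 4) by positivity]
    have key : M / q ^ 2 * ‖f r‖ + M / q ^ 2 = M * (1 + ‖f r‖) / q ^ 2 := by ring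
    rw [key]
    refine max_le ?_ ?_
    · simp only [hf', norm_smul, norm_inv, Real.norm_of_nonneg hq.le, Prod.fst_neg, norm_neg]
      rw [inv_mul_le_iff₀ hq]
      calc ‖(e' (t - r)).1‖ ≤ κ₁ * (2 + q * ‖f r‖ + q ^ 3 * ‖f r‖) :=
            (h₁ _ hr').trans (by gcongr; exacts [hn₁ r, hn₂ r])
        _ = κ₁ * (2 * q + q ^ 2 * ‖f r‖ + q ^ 4 * ‖f r‖) / q := by field_simp
        _ ≤ κ₁ * (2 * Q + Q ^ 2 * ‖f r‖ + Q ^ 4 * ‖f r‖) / q := by gcongr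
        _ ≤ κ₁ * ((2 * Q + Q ^ 2 + Q ^ 4) * (1 + ‖f r‖)) / q := by
            gcongr
            have : 0 ≤ 2 * Q * ‖f r‖ + Q ^ 2 + Q ^ 4 := by positivity
            linarith
        _ = κ₁ * (2 * Q + Q ^ 2 + Q ^ 4) * (1 + ‖f r‖) / q := by ring
        _ ≤ M * (1 + ‖f r‖) / q := by gcongr
        _ = q * (M * (1 + ‖f r‖) / q ^ 2) := by field_simp
    · simp only [hf', norm_smul, norm_inv, norm_pow, Real.norm_of_nonneg hq.le, Prod.snd_neg,
        norm_neg]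
      rw [inv_mul_le_iff₀ (by positivity)]
      calc ‖(e' (t - r)).2‖
          ≤ κ₂ * (q * ‖f r‖ + (q * q ^ γ * (1 + ‖f r‖) + 2 * (q ^ 3 * ‖f r‖))) :=
            (h₂ _ hr').trans (by gcongr; exacts [hn₁ r, hn₂ r])
        _ = q * (κ₂ * (‖f r‖ + q ^ γ * (1 + ‖f r‖) + 2 * q ^ 2 * ‖f r‖)) := by ring
        _ ≤ q * (κ₂ * ((1 + ‖f r‖) + Q ^ γ * (1 + ‖f r‖) + 2 * Q ^ 2 * (1 + ‖f r‖))) := by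
            gcongr <;> linarith
        _ = q * (κ₂ * (1 + Q ^ γ + 2 * Q ^ 2) * (1 + ‖f r‖)) := by ring
        _ ≤ q * (M * (1 + ‖f r‖)) := by gcongr
        _ = q ^ 3 * (M * (1 + ‖f r‖) / q ^ 2) := by field_simp
  have hG := norm_le_gronwallBound_of_norm_deriv_right_le (f := f) (f' := f') (a := 0)
    (b := q ^ 2) (continuous_iff_continuousAt.2 fun r => (hfd r).continuousAt).continuousOn
    (fun r _ => (hfd r).hasDerivWithinAt) h0 hbound
  have hN : 0 ≤ N := (norm_nonneg _).trans h0
  have hfin : ∀ r ∈ Set.Icc 0 (q ^ 2), ‖f r‖ ≤ Real.exp M * (N + 1) := by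
    intro r hr
    have hMq : M / q ^ 2 ≠ 0 := by positivity
    have h := hG r hr
    rw [gronwallBound_of_K_ne_0 hMq, div_self hMq, sub_zero] at h
    have hexp : Real.exp (M / q ^ 2 * r) ≤ Real.exp M := by
      rw [Real.exp_le_exp, div_mul_eq_mul_div, div_le_iff₀ (by positivity)]
      exact mul_le_mul_of_nonneg_left hr.2 hM0.le
    calc ‖f r‖ ≤ N * Real.exp (M / q ^ 2 * r) + 1 * (Real.exp (M / q ^ 2 * r) - 1) := h
      _ ≤ N * Real.exp M + 1 * (Real.exp M - 0) := by gcongr; norm_num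
      _ = Real.exp M * (N + 1) := by ring
  intro r hr
  have hr' : t - r ∈ Set.Icc 0 (q ^ 2) := ⟨by linarith [hr.2], by linarith [hr.1]⟩
  have k₁ := hn₁ (t - r)
  have k₂ := hn₂ (t - r)
  rw [sub_sub_cancel] at k₁ k₂
  exact ⟨k₁.trans (by gcongr; exact hfin _ hr'), k₂.trans (by gcongr; exact hfin _ hr')⟩

end Estimates

section TinvNorm

variable {d : ℕ} {h q : ℝ}

lemma TinvNorm_le (hq : 0 < q) (hh : q ^ 2 = h) (x : Vec d × Vec d) :
    TinvNorm h x ≤ ‖x.1‖ / q + ‖x.2‖ / q ^ 3 := by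
  subst hh
  refine Real.sqrt_le_iff.2 ⟨by positivity, ?_⟩
  have : 0 ≤ ‖x.1‖ / q * (‖x.2‖ / q ^ 3) := by positivity
  calc ‖x.1‖ ^ 2 / q ^ 2 + ‖x.2‖ ^ 2 / (q ^ 2) ^ 3
      = (‖x.1‖ / q) ^ 2 + (‖x.2‖ / q ^ 3) ^ 2 := by ring
    _ ≤ (‖x.1‖ / q + ‖x.2‖ / q ^ 3) ^ 2 := by nlinarith

lemma norm_fst_le_TinvNorm (hq : 0 < q) (hh : q ^ 2 = h) (x : Vec d × Vec d) :
    ‖x.1‖ ≤ q * TinvNorm h x := by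
  subst hh
  rw [← div_le_iff₀' hq]
  refine Real.le_sqrt_of_sq_le ?_
  rw [div_pow]
  exact le_add_of_nonneg_right (by positivity)

lemma norm_snd_le_TinvNorm (hq : 0 < q) (hh : q ^ 2 = h) (x : Vec d × Vec d) :
    ‖x.2‖ ≤ q ^ 3 * TinvNorm h x := by
  subst hh
  rw [← div_le_iff₀' (by positivity)]
  refine Real.le_sqrt_of_sq_le ?_
  rw [div_pow, ← pow_mul, ← pow_mul]
  exact le_add_of_nonneg_left (by positivity)

end TinvNorm

/-- **Deviation of the frozen linearized flow from the true flow (Lemma `Le32`, (TT8)).**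
Under the anisotropic Hölder assumptions `‖F₁(t,·)‖_{𝒞⁰_𝐝} ≤ κ₁`,
`‖F₂(t,·)‖_{𝒞^{1+γ}_𝐝} ≤ κ₂`, there is `C > 0`, depending only on `T, κ₁, κ₂, d, γ`, with
`|𝕋_{t-s}⁻¹(θ_{t,s}(x) - ϑ^{(t,y)}_{t,s}(x))| ≤ C (t-s)^{γ/2}(|𝕋_{t-s}⁻¹(θ_{t,s}(x)-y)|^{1+γ} + 1)`. -/
theorem frozen_flow_deviation
    (d : ℕ) (γ κ₁ κ₂ T : ℝ) (hγ : γ ∈ Set.Ioc (0 : ℝ) 1)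
    (hκ₁ : 0 < κ₁) (hκ₂ : 0 < κ₂) (hT : 0 < T) :
    ∃ C : ℝ, 0 < C ∧
      ∀ (F : ℝ → Vec d × Vec d → Vec d × Vec d)
        (θ : ℝ → ℝ → Vec d × Vec d → Vec d × Vec d)
        (ϑ : ℝ → (Vec d × Vec d) → ℝ → ℝ → (Vec d × Vec d) → Vec d × Vec d),
        -- `F` is smooth in space with all spatial derivatives bounded
        (∀ t, ContDiff ℝ (⊤ : ℕ∞) (F t)) →
        (∀ n : ℕ, 1 ≤ n → ∃ K : ℝ, ∀ t x, ‖iteratedFDeriv ℝ n (F t) x‖ ≤ K) →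
        -- bounds at the origin
        (∀ t : ℝ, 0 ≤ t → ‖(F t 0).1‖ ≤ κ₁ ∧ ‖(F t 0).2‖ ≤ κ₂) →
        -- `‖F₁(t,·)‖_{𝒞⁰_𝐝} ≤ κ₁`: oscillation bounds at scale ≤ 1 in each variable
        (∀ (t : ℝ) (x₂ z z' : Vec d), 0 ≤ t → ‖z - z'‖ ≤ 1 →
          ‖(F t (z, x₂)).1 - (F t (z', x₂)).1‖ ≤ κ₁) →
        (∀ (t : ℝ) (x₁ w w' : Vec d), 0 ≤ t → ‖w - w'‖ ≤ 1 →
          ‖(F t (x₁, w)).1 - (F t (x₁, w')).1‖ ≤ κ₁) →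
        -- `‖F₂(t,·)‖_{𝒞^{1+γ}_𝐝} ≤ κ₂`:
        (∀ (t : ℝ) (x : Vec d × Vec d), 0 ≤ t → ‖grad1F2 F t x‖ ≤ κ₂) →
        (∀ (t : ℝ) (x₂ z z' : Vec d), 0 ≤ t → ‖z - z'‖ ≤ 1 →
          ‖grad1F2 F t (z, x₂) - grad1F2 F t (z', x₂)‖ ≤ κ₂ * ‖z - z'‖ ^ γ) →
        (∀ (t : ℝ) (x₁ w w' : Vec d), 0 ≤ t → ‖w - w'‖ ≤ 1 →
          ‖(F t (x₁, w)).2 - (F t (x₁, w')).2‖ ≤ κ₂ * ‖w - w'‖ ^ ((1 + γ) / 3)) →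
        -- `θ` is the (forward and backward) flow of `F`
        (∀ s x, θ s s x = x) →
        (∀ s x t, HasDerivAt (fun u => θ u s x) (F t (θ t s x)) t) →
        -- `ϑ^{(τ,ξ)}` solves the frozen linearized integral equation
        (∀ (τ : ℝ) (ξ : Vec d × Vec d) (s : ℝ) (x : Vec d × Vec d) (t : ℝ),
          ϑ τ ξ t s x = x + ∫ r in s..t,
            (F r (θ r τ ξ) + Afun F r (θ r τ ξ) (ϑ τ ξ r s x - θ r τ ξ))) →
        ∀ (s t : ℝ) (x y : Vec d × Vec d), 0 ≤ s → s ≤ t → t ≤ T →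
          TinvNorm (t - s) (θ t s x - ϑ t y t s x)
            ≤ C * (t - s) ^ (γ / 2) *
              ((TinvNorm (t - s) (θ t s x - y)) ^ (1 + γ) + 1) := by
  obtain ⟨hγ0, hγ1⟩ := hγ
  set Q : ℝ := Real.sqrt T with hQdef
  have hQ : 0 < Q := Real.sqrt_pos.2 hT
  set M : ℝ := κ₁ * (2 * Q + Q ^ 2 + Q ^ 4) + κ₂ * (1 + Q ^ γ + 2 * Q ^ 2) with hM
  have hM0 : 0 < M := by positivity
  set L : ℝ := Real.exp M with hL
  have hL1 : 1 ≤ L := Real.one_le_exp hM0.le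
  set R : ℝ := Q ^ (1 - γ) with hR
  have hR0 : 0 < R := Real.rpow_pos_of_pos hQ _
  set L₁ : ℝ := κ₁ * (2 + Q * L + Q ^ 3 * L) with hL₁
  have hL₁0 : 0 < L₁ := by positivity
  set L₂ : ℝ := κ₂ * (2 * L + 2 * L * (Q * R) + 2 * L ^ 2 + L₁ * R) with hL₂
  have hL₂0 : 0 < L₂ := by positivity
  refine ⟨2 ^ γ * (L₁ * R + L₂), by positivity, ?_⟩
  intro F θ ϑ hsmooth hder horig hF₁₁ hF₁₂ hA hA₁ hF₂₂ hθ0 hθ hϑ s t x y hs hst htT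
  have hd : ∀ t, Differentiable ℝ (F t) := fun t => (hsmooth t).differentiable (by simp)
  obtain ⟨K, hK⟩ := hder 1 le_rfl
  have hLip : ∀ t, LipschitzWith K.toNNReal (F t) := fun t =>
    lipschitzWith_of_nnnorm_fderiv_le (𝕜 := ℝ) (hd t) fun z => by
      have h := hK t z
      rw [norm_iteratedFDeriv_one] at h
      exact NNReal.coe_le_coe.1 (h.trans (Real.le_coe_toNNReal K))
  have hm := measurable_uncurry_of_flow hLip hθ0 hθ
  have hF0 : ∀ t, 0 ≤ t → ‖F t 0‖ ≤ max κ₁ κ₂ := fun t ht =>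
    max_le_max (horig t ht).1 (horig t ht).2
  rcases hst.eq_or_lt with rfl | hlt
  · have : TinvNorm (s - s) (θ s s x - ϑ s y s s x) = 0 := by simp [TinvNorm]
    rw [this, sub_self]
    have := Real.rpow_nonneg (Real.sqrt_nonneg
      (‖(θ s s x - y).1‖ ^ 2 / 0 + ‖(θ s s x - y).2‖ ^ 2 / 0 ^ 3)) (1 + γ)
    unfold TinvNorm
    positivity
  set q : ℝ := Real.sqrt (t - s) with hqdef
  have hq : 0 < q := Real.sqrt_pos.2 (sub_pos.2 hlt)
  have hqq : q ^ 2 = t - s := Real.sq_sqrt (sub_pos.2 hlt).le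
  have hqQ : q ≤ Q := Real.sqrt_le_sqrt (by linarith)
  set W : ℝ := q ^ γ with hW
  have hW0 : 0 < W := Real.rpow_pos_of_pos hq _
  have hpow : (t - s) ^ (γ / 2) = W := by
    rw [← hqq, ← Real.rpow_natCast, ← Real.rpow_mul hq.le]
    congr 1
    push_cast
    ring
  have hqW : q ≤ R * W := by
    calc q = q ^ (1 - γ) * q ^ γ := by rw [← Real.rpow_add hq]; simp
      _ ≤ R * W := by
        gcongr
        exact Real.rpow_le_rpow hq.le hqQ (by linarith)
  set a : ℝ → Vec d × Vec d := fun r => θ r s x with ha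
  set b : ℝ → Vec d × Vec d := fun r => θ r t y with hb
  have had : ∀ r, HasDerivAt a (F r (a r)) r := hθ s x
  have hbd : ∀ r, HasDerivAt b (F r (b r)) r := hθ t y
  have has : a s = x := hθ0 s x
  have hbt : b t = y := hθ0 t y
  set N : ℝ := TinvNorm (t - s) (θ t s x - y) with hN
  have hN0 : 0 ≤ N := Real.sqrt_nonneg _
  set P : ℝ := N + 1 with hP
  have hP1 : 1 ≤ P := by linarith
  set S : ℝ := P ^ (1 + γ) with hS
  have hPS : P ≤ S := Real.self_le_rpow_of_one_le hP1 (by linarith)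
  have hr0 : ∀ r ∈ Set.Icc s t, 0 ≤ r := fun r hr => hs.trans hr.1
  have hinc₁ : ∀ r ∈ Set.Icc s t, ‖(F r (a r) - F r (b r)).1‖ ≤
      κ₁ * (2 + ‖(a r - b r).1‖ + ‖(a r - b r).2‖) := fun r hr =>
    norm_fst_field_sub_le (fun x₂ z z' => hF₁₁ r x₂ z z' (hr0 r hr))
      (fun x₁ w w' => hF₁₂ r x₁ w w' (hr0 r hr)) _ _
  have hgron := anisotropic_gronwall ⟨hγ0, hγ1⟩ hκ₁ hκ₂ hq hqQ hqq
    (fun r => (had r).sub (hbd r)) hinc₁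
    (fun r hr => norm_snd_field_sub_le hγ0 hκ₂.le hd (fun z => hA r z (hr0 r hr))
      (fun x₁ w w' => hF₂₂ r x₁ w w' (hr0 r hr)) _ _)
    (N := N) (by rw [Pi.sub_apply, hbt]; exact norm_fst_le_TinvNorm hq hqq _)
    (by rw [Pi.sub_apply, hbt]; exact norm_snd_le_TinvNorm hq hqq _)
  simp only [Pi.sub_apply, ← hM, ← hL, ← hP] at hgron
  have hD₁ : ∀ r ∈ Set.Icc s t, ‖(a r - b r).1 - (a s - b s).1‖ ≤ L₁ * P * q ^ 2 := by
    intro r hr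
    have hb₁ : ∀ u ∈ Set.Ico s t, ‖(F u (a u) - F u (b u)).1‖ ≤ L₁ * P := by
      intro u hu
      have hu' := Set.Ico_subset_Icc_self hu
      obtain ⟨g₁, g₂⟩ := hgron u hu'
      calc ‖(F u (a u) - F u (b u)).1‖ ≤ κ₁ * (2 + q * (L * P) + q ^ 3 * (L * P)) :=
            (hinc₁ u hu').trans (by gcongr)
        _ ≤ κ₁ * (2 * P + Q * (L * P) + Q ^ 3 * (L * P)) := by gcongr; linarith
        _ = L₁ * P := by rw [hL₁]; ring
    have hder₁ : ∀ u ∈ Set.Icc s t, HasDerivWithinAt (fun u => (a u - b u).1)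
        (F u (a u) - F u (b u)).1 (Set.Icc s t) u := fun u _ =>
      ((ContinuousLinearMap.fst ℝ (Vec d) (Vec d)).hasFDerivAt.comp_hasDerivAt u
        ((had u).sub (hbd u))).hasDerivWithinAt
    refine (norm_image_sub_le_of_norm_deriv_le_segment' hder₁ hb₁ r hr).trans ?_
    rw [hqq]
    gcongr
    exact hr.2
  obtain ⟨hGi, hveq⟩ := frozen_flow_eq hst hs hLip hd hm hF0 hA (b := b)
    (v := fun r => ϑ t y r s x) hbd (hϑ t y s x)
  have hac : Continuous a := continuous_iff_continuousAt.2 fun r => (had r).continuousAt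
  have hai := intervalIntegrable_comp_path hst hs hLip hm hF0 hac
  have hdev : θ t s x - ϑ t y t s x = ∫ r in s..t, (F r (a r) -
      (F r (b r) + ((0 : Vec d), grad1F2 F r (b r) (x.1 - (b s).1)))) := by
    rw [intervalIntegral.integral_sub hai hGi,
      intervalIntegral.integral_eq_sub_of_hasDerivAt (fun u _ => had u) hai]
    refine (congrArg (fun z => a t - z) hveq).trans ?_
    rw [has]
    abel
  have hdi := hai.sub hGi
  have hdev₁ : ‖(θ t s x - ϑ t y t s x).1‖ ≤ L₁ * P * q ^ 2 := by
    have hbi := intervalIntegrable_comp_path hst hs hLip hm hF0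
      (continuous_iff_continuousAt.2 fun r => (hbd r).continuousAt)
    have e : (θ t s x - ϑ t y t s x).1 = (a t - b t).1 - (a s - b s).1 := by
      have h₁ := (ContinuousLinearMap.fst ℝ (Vec d) (Vec d)).intervalIntegral_comp_comm hdi
      have h₂ := (ContinuousLinearMap.fst ℝ (Vec d) (Vec d)).intervalIntegral_comp_comm
        (hai.sub hbi)
      have h₃ := intervalIntegral.integral_eq_sub_of_hasDerivAt
        (fun u _ => (had u).sub (hbd u)) (hai.sub hbi)
      rw [hdev, ← Prod.fst_sub]
      refine h₁.symm.trans (Eq.trans ?_ (h₂.trans (congrArg Prod.fst h₃)))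
      simp
    rw [e]
    exact hD₁ t ⟨hst, le_rfl⟩
  have hdev₂ : ‖(θ t s x - ϑ t y t s x).2‖ ≤ L₂ * (q * W * S) * q ^ 2 := by
    have h₁ := (ContinuousLinearMap.snd ℝ (Vec d) (Vec d)).intervalIntegral_comp_comm hdi
    rw [hdev, hqq, ← abs_of_pos (sub_pos.2 hlt)]
    refine (congrArg norm h₁).symm.le.trans
      (intervalIntegral.norm_integral_le_of_norm_le_const fun r hr => ?_)
    rw [Set.uIoc_of_le hst] at hr
    have hr' := Set.Ioc_subset_Icc_self hr
    have hr0' := hr0 r hr'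
    obtain ⟨g₁, g₂⟩ := hgron r hr'
    have hLP : 1 ≤ L * P := one_le_mul_of_one_le_of_one_le hL1 hP1
    have t₁ := norm_snd_field_sub_sub_grad_le hγ0 hκ₂.le hd (fun z => hA r z hr0')
      (fun x₂ z z' => hA₁ r x₂ z z' hr0') (fun x₁ w w' => hF₂₂ r x₁ w w' hr0') (a r) (b r)
    have t₂ : ‖grad1F2 F r (b r) ((a r - b r).1 - (a s - b s).1)‖ ≤ κ₂ * (L₁ * P * q ^ 2) :=
      (ContinuousLinearMap.le_opNorm _ _).trans
        (mul_le_mul (hA r _ hr0') (hD₁ r hr') (norm_nonneg _) hκ₂.le)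
    have m₁ : ‖(a r).2 - (b r).2‖ ^ ((1 + γ) / 3) ≤ q * W * (1 + L * P) :=
      rpow_third_le ⟨hγ0, hγ1⟩ hq (norm_nonneg _) (by positivity) g₂
    have m₂ : ‖(a r).1 - (b r).1‖ ^ γ * ‖(a r).1 - (b r).1‖ ≤ q * W * (L ^ 2 * S) := by
      calc ‖(a r).1 - (b r).1‖ ^ γ * ‖(a r).1 - (b r).1‖
          ≤ (q * (L * P)) ^ γ * (q * (L * P)) :=
            mul_le_mul (Real.rpow_le_rpow (norm_nonneg _) g₁ hγ0.le) g₁ (norm_nonneg _)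
              (by positivity)
        _ = q * W * (L ^ γ * L * (P * P ^ γ)) := by
            rw [Real.mul_rpow hq.le (by positivity), Real.mul_rpow (by positivity) (by positivity)]
            ring
        _ = q * W * (L ^ γ * L * S) := by
            rw [hS, Real.rpow_add (by positivity), Real.rpow_one]
        _ ≤ q * W * (L ^ (1 : ℝ) * L * S) := by
            gcongr
        _ = q * W * (L ^ 2 * S) := by rw [Real.rpow_one, sq]
    calc ‖(F r (a r) - (F r (b r) + ((0 : Vec d), grad1F2 F r (b r) (x.1 - (b s).1)))).2‖
        = ‖((F r (a r)).2 - (F r (b r)).2 - grad1F2 F r (b r) ((a r).1 - (b r).1)) +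
            grad1F2 F r (b r) ((a r - b r).1 - (a s - b s).1)‖ := by
          congr 1
          simp only [Prod.snd_sub, Prod.snd_add, Prod.fst_sub, map_sub, has]
          abel
      _ ≤ κ₂ * (q * W * (1 + L * P) + 2 * (q ^ 3 * (L * P))) + 2 * κ₂ * (q * W * (L ^ 2 * S)) +
            κ₂ * (L₁ * P * q ^ 2) := by
          refine (norm_add_le _ _).trans (add_le_add (t₁.trans ?_) t₂)
          gcongr
          exact g₂
      _ = κ₂ * (q * W * (1 + L * P) + 2 * (q * q * q * (L * P)) + 2 * (q * W * (L ^ 2 * S)) +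
            L₁ * P * (q * q)) := by ring
      _ ≤ κ₂ * (q * W * (L * S + L * S) + 2 * (q * Q * (R * W) * (L * S)) +
            2 * (q * W * (L ^ 2 * S)) + L₁ * S * (q * (R * W))) := by
          gcongr
          exact hLP.trans (by gcongr)
      _ = L₂ * (q * W * S) := by rw [hL₂]; ring
  have hSN : S ≤ 2 ^ γ * (N ^ (1 + γ) + 1) := by
    have := NNReal.rpow_add_le_mul_rpow_add_rpow ⟨N, hN0⟩ 1 (by linarith : 1 ≤ 1 + γ)
    rw [add_sub_cancel_left, NNReal.one_rpow] at this
    exact_mod_cast this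
  rw [hpow]
  calc TinvNorm (t - s) (θ t s x - ϑ t y t s x)
      ≤ L₁ * P * q ^ 2 / q + L₂ * (q * W * S) * q ^ 2 / q ^ 3 :=
        (TinvNorm_le hq hqq _).trans (by gcongr)
    _ = L₁ * (P * q) + L₂ * (W * S) := by field_simp
    _ ≤ L₁ * (S * (R * W)) + L₂ * (W * S) := by gcongr
    _ = (L₁ * R + L₂) * W * S := by ring
    _ ≤ (L₁ * R + L₂) * W * (2 ^ γ * (N ^ (1 + γ) + 1)) := by gcongr
    _ = 2 ^ γ * (L₁ * R + L₂) * W * (N ^ (1 + γ) + 1) := by ring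

end
end

section
/- Let F = (F₁,F₂) : [0,∞) × ℝ^{2d} → ℝ^d × ℝ^d be C¹ in space with bounded spatial gradient, satisfying (AX1) and (AX2), and let θ_{t,s} be its flow. Define p̂_λ(s,x;t,y) := g_λ(t−s, θ_{t,s}(x)−y). Then for any T, λ > 0 and α > 0 there exist λ′ > λ and C > 0, depending only on T, κ₁, κ₂, d, λ, α, such that for all 0 ≤ s < t ≤ T and x, y ∈ ℝ^{2d}: ( |θ_{t,s}(x) − y|_𝐝^α + |x − θ_{s,t}(y)|_𝐝^α )·p̂_λ(s,x;t,y) ≤ C·(t−s)^{α/2}·p̂_{λ′}(s,x;t,y). -/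
open MeasureTheory Real

noncomputable section

/-- The Euclidean norm of a point of `ℝ^{2d} = ℝ^d × ℝ^d`. -/
def nrm2 {d : ℕ} (x : Vec d × Vec d) : ℝ := Real.sqrt (‖x.1‖ ^ 2 + ‖x.2‖ ^ 2)

/-- The anisotropic quasi-norm `|x|_𝐝 := |x₁| + |x₂|^{1/3}`. -/
def dnorm {d : ℕ} (x : Vec d × Vec d) : ℝ := ‖x.1‖ + ‖x.2‖ ^ ((1 : ℝ) / 3)

/-- `|𝕋_t⁻¹ x|²` for `x ∈ ℝ^{2d}`. -/
def TinvSq {d : ℕ} (t : ℝ) (x : Vec d × Vec d) : ℝ := ‖x.1‖ ^ 2 / t + ‖x.2‖ ^ 2 / t ^ 3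

/-- The anisotropic Gaussian kernel `g_λ(t,x) := t^{-2d} exp(-|𝕋_t⁻¹x|²/(2λ))`. -/
def gker (d : ℕ) (l t : ℝ) (x : Vec d × Vec d) : ℝ :=
  (t ^ (2 * d))⁻¹ * Real.exp (-(TinvSq t x) / (2 * l))

/-- The flow-centered Gaussian kernel `p̂_λ(s,x;t,y) := g_λ(t-s, θ_{t,s}(x) - y)`. -/
def phat (d : ℕ) (θ : ℝ → ℝ → Vec d × Vec d → Vec d × Vec d)
    (l s : ℝ) (x : Vec d × Vec d) (t : ℝ) (y : Vec d × Vec d) : ℝ :=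
  gker d l (t - s) (θ t s x - y)

theorem nrm2_le_add {d : ℕ} (x : Vec d × Vec d) : nrm2 x ≤ ‖x.1‖ + ‖x.2‖ := by
  unfold nrm2
  apply Real.sqrt_le_iff.2
  constructor
  · positivity
  · nlinarith [norm_nonneg x.1, norm_nonneg x.2, mul_nonneg (norm_nonneg x.1) (norm_nonneg x.2)]

theorem dnorm_nonneg {d : ℕ} (x : Vec d × Vec d) : 0 ≤ dnorm x := by
  unfold dnorm
  positivity

theorem rpow_third_le_s17 {p N b : ℝ} (hp : 0 ≤ p) (hN : 0 ≤ N) (hb : 0 ≤ b) (h : b ≤ p ^ 3 * N) :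
    b ^ ((1 : ℝ) / 3) ≤ p * (1 + N) := by
  have h1 : b ≤ (p * (1 + N)) ^ 3 := by
    have : N ≤ (1 + N) ^ 3 := by nlinarith [mul_nonneg hN hN, pow_nonneg hN 3]
    calc b ≤ p ^ 3 * N := h
      _ ≤ p ^ 3 * (1 + N) ^ 3 := by gcongr
      _ = _ := by ring
  have h0 : 0 ≤ p * (1 + N) := by positivity
  calc b ^ ((1 : ℝ) / 3) ≤ ((p * (1 + N)) ^ 3) ^ ((1 : ℝ) / 3) := by gcongr
    _ = p * (1 + N) := by
      rw [← Real.rpow_natCast, ← Real.rpow_mul h0]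
      norm_num

/-- A point whose rescaled components are at most `N` has quasi-norm `O(p (1 + N))`. -/
theorem dnorm_le {d : ℕ} {p N : ℝ} (hp : 0 ≤ p) (hN : 0 ≤ N) {x : Vec d × Vec d}
    (h1 : ‖x.1‖ ≤ p * N) (h2 : ‖x.2‖ ≤ p ^ 3 * N) : dnorm x ≤ 2 * p * (1 + N) := by
  have := rpow_third_le_s17 hp hN (norm_nonneg _) h2
  unfold dnorm
  nlinarith

/-- The anisotropic rescaling `𝕋_{p²}⁻¹` of `ℝ^d × ℝ^d`. -/
def rescale {d : ℕ} (p : ℝ) (x : Vec d × Vec d) : Vec d × Vec d :=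
  (p⁻¹ • x.1, (p ^ 3)⁻¹ • x.2)

theorem rescale_smul {d : ℕ} (p c : ℝ) (x : Vec d × Vec d) :
    rescale p (c • x) = c • rescale p x := by
  ext1 <;> exact smul_comm _ _ _

theorem norm_fst_le_rescale {d : ℕ} {p : ℝ} (hp : 0 < p) (x : Vec d × Vec d) :
    ‖x.1‖ ≤ p * ‖rescale p x‖ := by
  have h := norm_fst_le (rescale p x)
  simp only [rescale, norm_smul, norm_inv, Real.norm_of_nonneg hp.le] at h ⊢
  exact (inv_mul_le_iff₀ hp).1 h

theorem norm_snd_le_rescale {d : ℕ} {p : ℝ} (hp : 0 < p) (x : Vec d × Vec d) :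
    ‖x.2‖ ≤ p ^ 3 * ‖rescale p x‖ := by
  have hp3 : 0 < p ^ 3 := by positivity
  have h := norm_snd_le (rescale p x)
  simp only [rescale, norm_smul, norm_inv, Real.norm_of_nonneg hp3.le] at h ⊢
  exact (inv_mul_le_iff₀ hp3).1 h

theorem norm_rescale_le {d : ℕ} {p B : ℝ} (hp : 0 < p) {x : Vec d × Vec d}
    (h1 : ‖x.1‖ ≤ p * B) (h2 : ‖x.2‖ ≤ p ^ 3 * B) : ‖rescale p x‖ ≤ B := by
  have hp3 : 0 < p ^ 3 := by positivity
  apply norm_prod_le_iff.2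
  simp only [rescale, norm_smul, norm_inv, Real.norm_of_nonneg hp.le, Real.norm_of_nonneg hp3.le]
  exact ⟨(inv_mul_le_iff₀ hp).2 h1, (inv_mul_le_iff₀ hp3).2 h2⟩

theorem norm_rescale_sq_le_TinvSq {d : ℕ} {p : ℝ} (hp : 0 < p) (x : Vec d × Vec d) :
    ‖rescale p x‖ ^ 2 ≤ TinvSq (p ^ 2) x := by
  have h0 : 0 ≤ TinvSq (p ^ 2) x := by unfold TinvSq; positivity
  rw [← Real.sq_sqrt h0]
  have e1 : ‖x.1‖ ^ 2 ≤ p ^ 2 * TinvSq (p ^ 2) x := by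
    have : p ^ 2 * TinvSq (p ^ 2) x = ‖x.1‖ ^ 2 + ‖x.2‖ ^ 2 / p ^ 4 := by
      unfold TinvSq; field_simp
    rw [this]
    exact le_add_of_nonneg_right (by positivity)
  have e2 : ‖x.2‖ ^ 2 ≤ p ^ 6 * TinvSq (p ^ 2) x := by
    have : p ^ 6 * TinvSq (p ^ 2) x = p ^ 4 * ‖x.1‖ ^ 2 + ‖x.2‖ ^ 2 := by
      unfold TinvSq; field_simp
    rw [this]
    exact le_add_of_nonneg_left (by positivity)
  gcongr
  apply norm_rescale_le hp
  · apply le_of_sq_le_sq _ (by positivity)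
    rw [mul_pow, Real.sq_sqrt h0]
    exact e1
  · apply le_of_sq_le_sq _ (by positivity)
    rw [mul_pow, Real.sq_sqrt h0, ← pow_mul]
    exact e2

/-- Growth rate of the rescaled difference of two trajectories. -/
theorem norm_rescale_drift_le {d : ℕ} {p P κ₁ κ₂ : ℝ} (hp : 0 < p) (hpP : p ≤ P)
    (hκ₁ : 0 ≤ κ₁) (hκ₂ : 0 ≤ κ₂) {w f : Vec d × Vec d}
    (h1 : ‖f.1‖ ≤ κ₁ * (1 + nrm2 w))
    (h2 : ‖f.2‖ ≤ κ₂ * (‖w.1‖ + ‖w.2‖ ^ ((1 : ℝ) / 3) + ‖w.2‖)) :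
    p ^ 2 * ‖rescale p f‖ ≤ (κ₁ * (P + P ^ 2 + P ^ 4) + κ₂ * (2 + P ^ 2)) * (‖rescale p w‖ + 1) := by
  set N := ‖rescale p w‖ with hN
  have hN0 : 0 ≤ N := norm_nonneg _
  have hw1 := norm_fst_le_rescale hp w
  have hw2 := norm_snd_le_rescale hp w
  rw [← hN] at hw1 hw2
  have hw3 := rpow_third_le_s17 hp.le hN0 (norm_nonneg _) hw2
  have hw := nrm2_le_add w
  have hP : 0 < P := hp.trans_le hpP
  set A := κ₁ * (P + P ^ 2 + P ^ 4) with hA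
  set B := κ₂ * (2 + P ^ 2) with hB
  have hA0 : 0 ≤ A := by positivity
  have hB0 : 0 ≤ B := by positivity
  rw [← le_div_iff₀' (by positivity)]
  apply norm_rescale_le hp
  · have : p * ((A + B) * (N + 1) / p ^ 2) = (A + B) * (N + 1) / p := by field_simp
    rw [this, le_div_iff₀ hp]
    calc ‖f.1‖ * p ≤ κ₁ * (1 + (p * N + p ^ 3 * N)) * p := by
          gcongr
          exact h1.trans (by gcongr; linarith)
      _ = κ₁ * (p + p ^ 2 * N + p ^ 4 * N) := by ring
      _ ≤ κ₁ * (P + P ^ 2 * N + P ^ 4 * N) := by gcongr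
      _ ≤ κ₁ * ((P + P ^ 2 + P ^ 4) * (N + 1)) := by
        gcongr
        nlinarith [mul_nonneg hP.le hN0, pow_pos hP 2, pow_pos hP 4]
      _ = A * (N + 1) := by rw [hA]; ring
      _ ≤ (A + B) * (N + 1) := by gcongr; linarith
  · have : p ^ 3 * ((A + B) * (N + 1) / p ^ 2) = p * ((A + B) * (N + 1)) := by field_simp
    rw [this]
    calc ‖f.2‖ ≤ κ₂ * (p * N + p * (1 + N) + p ^ 3 * N) := h2.trans (by gcongr)
      _ = p * (κ₂ * (N + (1 + N) + p ^ 2 * N)) := by ring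
      _ ≤ p * (κ₂ * (N + (1 + N) + P ^ 2 * N)) := by gcongr
      _ ≤ p * (κ₂ * ((2 + P ^ 2) * (N + 1))) := by
        gcongr
        nlinarith [pow_pos hP 2]
      _ = p * (B * (N + 1)) := by rw [hB]; ring
      _ ≤ p * ((A + B) * (N + 1)) := by gcongr; linarith

/-- Backward Grönwall estimate for a rescaled curve. -/
theorem one_add_norm_rescale_le_of_deriv {d : ℕ} {p K s t : ℝ} (hp : 0 < p) (hK : 0 < K)
    (hst : t - s = p ^ 2) {w w' : ℝ → Vec d × Vec d} (hw : ∀ r, HasDerivAt w (w' r) r)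
    (hbound : ∀ r ∈ Set.Icc s t, p ^ 2 * ‖rescale p (w' r)‖ ≤ K * (‖rescale p (w r)‖ + 1)) :
    1 + ‖rescale p (w s)‖ ≤ Real.exp K * (1 + ‖rescale p (w t)‖) := by
  have hd : ∀ r, HasDerivAt (fun u => rescale p (w (t - p ^ 2 * u)))
      (-(p ^ 2) • rescale p (w' (t - p ^ 2 * r))) r := by
    intro r
    have hi : HasDerivAt (fun u : ℝ => t - p ^ 2 * u) (-(p ^ 2)) r := by
      simpa using ((hasDerivAt_id r).const_mul (p ^ 2)).const_sub t
    have hc := (hw (t - p ^ 2 * r)).scomp r hi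
    have := ((hasFDerivAt_fst.comp_hasDerivAt r hc).const_smul p⁻¹).prodMk
      ((hasFDerivAt_snd.comp_hasDerivAt r hc).const_smul (p ^ 3)⁻¹)
    rw [← rescale_smul]
    exact this
  have hg := norm_le_gronwallBound_of_norm_deriv_right_le
    (f := fun u => rescale p (w (t - p ^ 2 * u)))
    (f' := fun r => -(p ^ 2) • rescale p (w' (t - p ^ 2 * r)))
    (δ := ‖rescale p (w t)‖) (K := K) (ε := K) (a := 0) (b := 1)
    (fun r _ => (hd r).continuousAt.continuousWithinAt)
    (fun r _ => (hd r).hasDerivWithinAt) (by simp)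
    (fun r hr => by
      have hb := hbound (t - p ^ 2 * r)
        ⟨by nlinarith [hr.2, pow_pos hp 2], by nlinarith [hr.1, pow_pos hp 2]⟩
      rw [norm_smul, norm_neg, Real.norm_of_nonneg (by positivity)]
      linarith)
    1 (by simp)
  rw [gronwallBound_of_K_ne_0 hK.ne'] at hg
  have hs : t - p ^ 2 = s := by linarith
  simp only [sub_zero, mul_one, hs, div_self hK.ne', one_mul] at hg
  linarith

theorem one_add_rpow_mul_exp_le {l α x q : ℝ} (hl : 0 < l) (hα : 0 ≤ α) (hx : 0 ≤ x)
    (hq : x ^ 2 ≤ q) :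
    (1 + x) ^ α * Real.exp (-q / (2 * l)) ≤
      Real.exp (α ^ 2 * l) * Real.exp (-q / (2 * (2 * l))) := by
  have h1 : (1 + x) ^ α ≤ Real.exp (α * x) := by
    rw [mul_comm, Real.exp_mul]
    gcongr
    linarith [Real.add_one_le_exp x]
  calc (1 + x) ^ α * Real.exp (-q / (2 * l)) ≤ Real.exp (α * x) * Real.exp (-q / (2 * l)) := by
        gcongr
    _ ≤ _ := by
      rw [← Real.exp_add, ← Real.exp_add, Real.exp_le_exp]
      have h2 : α ^ 2 * l + -q / (2 * (2 * l)) - (α * x + -q / (2 * l))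
          = ((2 * l * α - x) ^ 2 + (q - x ^ 2)) / (4 * l) := by
        field_simp
        ring
      have h3 : 0 ≤ ((2 * l * α - x) ^ 2 + (q - x ^ 2)) / (4 * l) :=
        div_nonneg (add_nonneg (sq_nonneg _) (by linarith)) (by positivity)
      linarith

/-- **Absorption of anisotropic polynomial factors by Gaussian kernels (Lemma `Le33`,
(`regularizing_proxy`)).**
For any `T, λ > 0` and `α > 0` there are `λ′ > λ` and `C > 0`, depending only on
`T, κ₁, κ₂, d, λ, α`, such that
`(|θ_{t,s}(x)-y|_𝐝^α + |x-θ_{s,t}(y)|_𝐝^α) p̂_λ(s,x;t,y) ≤ C (t-s)^{α/2} p̂_{λ′}(s,x;t,y)`. -/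
theorem gaussian_absorbs_anisotropic_distance
    (d : ℕ) (κ₁ κ₂ T l α : ℝ) (hκ₁ : 0 < κ₁) (hκ₂ : 0 < κ₂) (hT : 0 < T)
    (hl : 0 < l) (hα : 0 < α) :
    ∃ l' C : ℝ, l < l' ∧ 0 < C ∧
      ∀ (F : ℝ → Vec d × Vec d → Vec d × Vec d)
        (θ : ℝ → ℝ → Vec d × Vec d → Vec d × Vec d),
        -- `F` is C¹ in the space variable with bounded spatial gradient
        (∀ t, ContDiff ℝ 1 (F t)) →
        (∃ K : ℝ, ∀ t x, ‖fderiv ℝ (F t) x‖ ≤ K) →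
        -- (AX1)
        (∀ t : ℝ, 0 ≤ t → ∀ x y : Vec d × Vec d,
          ‖(F t x).1 - (F t y).1‖ ≤ κ₁ * (1 + nrm2 (x - y))) →
        -- (AX2)
        (∀ t : ℝ, 0 ≤ t → ∀ x y : Vec d × Vec d,
          ‖(F t x).2 - (F t y).2‖ ≤
            κ₂ * (‖(x - y).1‖ + ‖(x - y).2‖ ^ ((1 : ℝ) / 3) + ‖(x - y).2‖)) →
        -- `θ` is the (forward and backward) flow of `F`
        (∀ s x, θ s s x = x) →
        (∀ s x t, HasDerivAt (fun u => θ u s x) (F t (θ t s x)) t) →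
        ∀ (s t : ℝ) (x y : Vec d × Vec d), 0 ≤ s → s < t → t ≤ T →
          ((dnorm (θ t s x - y)) ^ α + (dnorm (x - θ s t y)) ^ α) * phat d θ l s x t y
            ≤ C * (t - s) ^ (α / 2) * phat d θ l' s x t y := by
  set K := κ₁ * (√T + √T ^ 2 + √T ^ 4) + κ₂ * (2 + √T ^ 2) with hK
  have hK0 : 0 < K := by positivity
  refine ⟨2 * l, 2 * (2 * Real.exp K) ^ α * Real.exp (α ^ 2 * l), by linarith, by positivity, ?_⟩
  intro F θ _ _ hF1 hF2 hθ0 hθ s t x y hs hst htT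
  have hτ : 0 < t - s := sub_pos.2 hst
  set p := √(t - s) with hp_def
  have hp : 0 < p := Real.sqrt_pos.2 hτ
  have hp2 : t - s = p ^ 2 := (Real.sq_sqrt hτ.le).symm
  have hpT : p ≤ √T := Real.sqrt_le_sqrt (by linarith)
  have hgron := one_add_norm_rescale_le_of_deriv hp hK0 hp2
    (w := fun r => θ r s x - θ r t y) (fun r => (hθ s x r).sub (hθ t y r))
    (fun r hr => norm_rescale_drift_le hp hpT hκ₁.le hκ₂.le
      (hF1 r (hs.trans hr.1) _ _) (hF2 r (hs.trans hr.1) _ _))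
  simp only [hθ0] at hgron
  set z := θ t s x - y with hz
  set N := ‖rescale p z‖ with hN
  have hN0 : 0 ≤ N := norm_nonneg _
  set D := 2 * Real.exp K * p * (1 + N) with hD
  have hz_le : dnorm z ≤ D := by
    refine (dnorm_le hp.le hN0 (norm_fst_le_rescale hp z) (norm_snd_le_rescale hp z)).trans ?_
    have h1 : 1 ≤ Real.exp K := Real.one_le_exp hK0.le
    have h2 : 0 ≤ p * (1 + N) := by positivity
    nlinarith
  have hx_le : dnorm (x - θ s t y) ≤ D := by
    refine (dnorm_le hp.le (norm_nonneg _) (norm_fst_le_rescale hp _)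
      (norm_snd_le_rescale hp _)).trans ?_
    calc _ ≤ 2 * p * (Real.exp K * (1 + N)) := by gcongr
      _ = D := by rw [hD]; ring
  have hsum : dnorm z ^ α + dnorm (x - θ s t y) ^ α ≤ 2 * D ^ α := by
    have h1 := Real.rpow_le_rpow (dnorm_nonneg _) hz_le hα.le
    have h2 := Real.rpow_le_rpow (dnorm_nonneg _) hx_le hα.le
    linarith
  have hDα : D ^ α = (2 * Real.exp K) ^ α * (t - s) ^ (α / 2) * (1 + N) ^ α := by
    rw [hD, Real.mul_rpow (by positivity) (by positivity),
      Real.mul_rpow (by positivity) hp.le, hp_def, Real.sqrt_eq_rpow, ← Real.rpow_mul hτ.le,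
      one_div_mul_eq_div]
  have hgauss := one_add_rpow_mul_exp_le hl hα.le hN0 (norm_rescale_sq_le_TinvSq hp z)
  rw [← hp2] at hgauss
  unfold phat gker
  rw [← hz]
  set c := ((t - s) ^ (2 * d))⁻¹ with hc
  have hc0 : 0 ≤ c := by positivity
  calc _ ≤ 2 * D ^ α * (c * Real.exp (-(TinvSq (t - s) z) / (2 * l))) := by gcongr
    _ = 2 * (2 * Real.exp K) ^ α * (t - s) ^ (α / 2) * c *
        ((1 + N) ^ α * Real.exp (-(TinvSq (t - s) z) / (2 * l))) := by rw [hDα]; ring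
    _ ≤ 2 * (2 * Real.exp K) ^ α * (t - s) ^ (α / 2) * c *
        (Real.exp (α ^ 2 * l) * Real.exp (-(TinvSq (t - s) z) / (2 * (2 * l)))) := by gcongr
    _ = _ := by ring

end
end
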